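/- Let G be a finite primitive permutation group in which a point-stabilizer is abelian. Then the socle of G is a regular elementary abelian p-group for some prime p, and the point-stabilizers of G are cyclic of order coprime to p. -/

import Mathlib

/-- `N` is a minimal normal subgroup of `G`. -/
def IsMinimalNormalSubgroup {G : Type*} [Group G] (N : Subgroup G) : Prop :=
  N.Normal ∧ N ≠ ⊥ ∧ ∀ M : Subgroup G, M.Normal → M ≤ N → M ≠ ⊥ → M = N

/-- The socle of a group: the subgroup generated by all minimal normal subgroups. -/
def socle (G : Type*) [Group G] : Subgroup G :=
  ⨆ (N : Subgroup G) (_ : IsMinimalNormalSubgroup N), N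


theorem pas_sylow_smul {A N : Type*} [CommGroup A] [Group N] [MulDistribMulAction A N] {p : ℕ}
    (a : A) (n : N) (P : Sylow p N) : a • (n • P) = (a • n) • (a • P) := by
  apply Sylow.ext
  ext y
  simp only [Sylow.pointwise_smul_def, Sylow.coe_subgroup_smul,
    Subgroup.mem_pointwise_smul_iff_inv_smul_mem]
  simp [← map_inv]

theorem pas_invariant_sylow {A N : Type*} [CommGroup A] [Group N] [Finite A] [Finite N]
    [MulDistribMulAction A N]
    (hfree : ∀ a : A, a ≠ 1 → ∀ n : N, a • n = n → n = 1)
    (hcop : (Nat.card A).Coprime (Nat.card N)) (p : ℕ) [hp : Fact p.Prime] :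
    ∃ P : Sylow p N, ∀ a : A, a • P = P := by
  by_cases hA : Nat.card A = 1
  · have := (Nat.card_eq_one_iff_unique.1 hA).1
    exact ⟨default, fun a => by rw [Subsingleton.elim a 1, one_smul]⟩
  have : Fact (Nat.card A).minFac.Prime := ⟨Nat.minFac_prime hA⟩
  obtain ⟨x, hx⟩ := exists_prime_orderOf_dvd_card' (G := A) _ (Nat.minFac_dvd (Nat.card A))
  have hx1 : x ≠ 1 := by
    rintro rfl
    rw [orderOf_one] at hx
    exact (Nat.minFac_prime hA).one_lt.ne hx
  obtain ⟨P, hP⟩ : ∃ P : Sylow p N, x • P = P := by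
    have hpg : IsPGroup (Nat.card A).minFac (Subgroup.zpowers x) :=
      IsPGroup.of_card (n := 1) (by rw [Nat.card_zpowers, hx, pow_one])
    have hnd : ¬ (Nat.card A).minFac ∣ Nat.card (Sylow p N) := by
      intro h
      have h2 : Nat.card (Sylow p N) ∣ Nat.card N :=
        ((default : Sylow p N).card_dvd_index).trans (Subgroup.index_dvd_card _)
      exact (Nat.minFac_prime hA).one_lt.ne'
        (Nat.eq_one_of_dvd_coprimes hcop (Nat.minFac_dvd _) (h.trans h2))
    obtain ⟨P, hP⟩ := hpg.nonempty_fixed_point_of_prime_not_dvd_card (Sylow p N) hnd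
    exact ⟨P, hP ⟨x, Subgroup.mem_zpowers x⟩⟩
  refine ⟨P, fun a => ?_⟩
  obtain ⟨n, hn⟩ := MulAction.exists_smul_eq N P (a • P)
  have hxn : n⁻¹ * x • n ∈ MulAction.stabilizer N P := by
    rw [MulAction.mem_stabilizer_iff, mul_smul, inv_smul_eq_iff]
    conv_lhs => rw [← hP]
    rw [← pas_sylow_smul, hn, smul_comm, hP]
  have hM : ∀ m ∈ MulAction.stabilizer N P, m⁻¹ * x • m ∈ MulAction.stabilizer N P := by
    intro m hm
    refine mul_mem (inv_mem hm) ?_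
    rw [MulAction.mem_stabilizer_iff] at hm ⊢
    conv_lhs => rw [← hP]
    rw [← pas_sylow_smul, hm, hP]
  have key : ∀ m m' : N, m⁻¹ * x • m = m'⁻¹ * x • m' → m = m' := by
    intro m m' h
    have : x • (m' * m⁻¹) = m' * m⁻¹ := by
      rw [smul_mul', smul_inv']
      have h' : x • m = m * (m'⁻¹ * x • m') := by rw [← h]; group
      rw [h']; group
    exact (mul_inv_eq_one.1 (hfree x hx1 _ this)).symm
  let f : MulAction.stabilizer N P → MulAction.stabilizer N P := fun m => ⟨_, hM m m.2⟩
  have hf : Function.Injective f := fun m m' h => Subtype.ext (key _ _ (congrArg Subtype.val h))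
  obtain ⟨m, hm⟩ := (Finite.surjective_of_injective hf) ⟨_, hxn⟩
  have : (m : N) = n := key _ _ (congrArg Subtype.val hm)
  rw [← hn, ← this]
  exact m.2

theorem pas_structure {A N : Type*} [CommGroup A] [Group N] [Finite A] [Finite N] [Nontrivial N]
    [MulDistribMulAction A N]
    (hfree : ∀ a : A, a ≠ 1 → ∀ n : N, a • n = n → n = 1)
    (hcop : (Nat.card A).Coprime (Nat.card N))
    (hirr : ∀ M : Subgroup N, (∀ a : A, ∀ m ∈ M, a • m ∈ M) → M = ⊥ ∨ M = ⊤) :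
    ∃ p : ℕ, p.Prime ∧ (Nat.card A).Coprime p ∧ (∀ x y : N, x * y = y * x) ∧
      ∀ x : N, x ^ p = 1 := by
  have hN : Nat.card N ≠ 1 := Finite.one_lt_card.ne'
  let p := (Nat.card N).minFac
  have hpp : p.Prime := Nat.minFac_prime hN
  have : Fact p.Prime := ⟨hpp⟩
  have hpd : p ∣ Nat.card N := Nat.minFac_dvd _
  obtain ⟨P, hP⟩ := pas_invariant_sylow hfree hcop p
  have hPtop : (P : Subgroup N) = ⊤ := by
    refine (hirr P fun a m hm => ?_).resolve_left (P.ne_bot_of_dvd_card hpd)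
    have := Subgroup.smul_mem_pointwise_smul m a (P : Subgroup N) hm
    rwa [← Sylow.pointwise_smul_def, hP] at this
  have hpg : IsPGroup p N := by
    have := P.isPGroup'
    rw [hPtop] at this
    exact this.of_equiv Subgroup.topEquiv
  have hcomm : ∀ x y : N, x * y = y * x := by
    have hc : Subgroup.center N = ⊤ := by
      refine (hirr _ fun a m hm => ?_).resolve_left ?_
      · rw [Subgroup.mem_center_iff] at hm ⊢
        intro g
        have := congrArg (a • ·) (hm (a⁻¹ • g))
        simpa using this
      · have := hpg.center_nontrivial
        exact (Subgroup.nontrivial_iff_ne_bot _).1 this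
    intro x y
    have : y ∈ Subgroup.center N := hc ▸ Subgroup.mem_top y
    exact Subgroup.mem_center_iff.1 this x
  refine ⟨p, hpp, hcop.coprime_dvd_right hpd, hcomm, ?_⟩
  let K : Subgroup N :=
    { carrier := {x | x ^ p = 1}
      one_mem' := one_pow p
      mul_mem' := fun {a b} ha hb => by
        have ha' : a ^ p = 1 := ha
        have hb' : b ^ p = 1 := hb
        show (a * b) ^ p = 1
        rw [Commute.mul_pow (hcomm a b), ha', hb', one_mul]
      inv_mem' := fun {a} ha => by
        have ha' : a ^ p = 1 := ha
        show (a⁻¹) ^ p = 1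
        rw [inv_pow, ha', inv_one] }
  have hK : K = ⊤ := by
    refine (hirr K fun a m hm => ?_).resolve_left ?_
    · have hm' : m ^ p = 1 := hm
      show (a • m) ^ p = 1
      rw [← smul_pow', hm', smul_one]
    · obtain ⟨x, hx⟩ := exists_prime_orderOf_dvd_card' (G := N) p hpd
      intro hb
      have : x ∈ K := show x ^ p = 1 by rw [← hx, pow_orderOf_eq_one]
      rw [hb, Subgroup.mem_bot] at this
      rw [this, orderOf_one] at hx
      exact hpp.one_lt.ne hx
  intro x
  have : x ∈ K := hK ▸ Subgroup.mem_top x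
  exact this

theorem pas_cyclic {A V : Type*} [CommGroup A] [AddCommGroup V] [Finite A] [Nontrivial V]
    [DistribMulAction A V]
    (hfree : ∀ a : A, (∀ n : V, a • n = n) → a = 1)
    (hirr : ∀ M : AddSubgroup V, (∀ a : A, ∀ m ∈ M, a • m ∈ M) → M = ⊥ ∨ M = ⊤) :
    IsCyclic A := by
  let φ : A →* AddMonoid.End V := DistribMulAction.toAddMonoidEnd A V
  have hcomm : ∀ x ∈ Set.range φ, ∀ y ∈ Set.range φ, x * y = y * x := by
    rintro _ ⟨a, rfl⟩ _ ⟨b, rfl⟩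
    rw [← map_mul, ← map_mul, mul_comm]
  let : CommRing (Subring.closure (Set.range φ)) := Subring.closureCommRingOfComm hcomm
  let ψ : A →* Subring.closure (Set.range φ) :=
    φ.codRestrict _ (fun a => Subring.subset_closure ⟨a, rfl⟩)
  have : NoZeroDivisors (Subring.closure (Set.range φ)) := by
    refine ⟨fun {r s} h => ?_⟩
    have hk := hirr (AddMonoidHom.ker (r : AddMonoid.End V)) (fun a m hm => ?_)
    · rcases hk with hk | hk
      · right
        ext v
        have : (r : AddMonoid.End V) ((s : AddMonoid.End V) v) = 0 :=
          DFunLike.congr_fun (congrArg Subtype.val h) v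
        have h2 : (s : AddMonoid.End V) v ∈ AddMonoidHom.ker (r : AddMonoid.End V) := this
        rw [hk] at h2
        exact h2
      · left
        ext v
        have h2 : v ∈ AddMonoidHom.ker (r : AddMonoid.End V) := hk ▸ AddSubgroup.mem_top v
        exact h2
    · have hc := DFunLike.congr_fun (congrArg Subtype.val (mul_comm r (ψ a))) m
      have hc' : (r : AddMonoid.End V) (a • m) = a • (r : AddMonoid.End V) m := hc
      have hm' : (r : AddMonoid.End V) m = 0 := hm
      show (r : AddMonoid.End V) (a • m) = 0
      rw [hc', hm', smul_zero]
  have : Nontrivial (Subring.closure (Set.range φ)) := by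
    obtain ⟨v, hv⟩ := exists_ne (0 : V)
    refine ⟨1, 0, fun h => hv ?_⟩
    exact DFunLike.congr_fun (congrArg Subtype.val h) v
  have : IsDomain (Subring.closure (Set.range φ)) := NoZeroDivisors.to_isDomain _
  refine isCyclic_of_subgroup_isDomain ψ ((injective_iff_map_eq_one ψ).2 fun a ha => ?_)
  exact hfree a fun n => DFunLike.congr_fun (congrArg Subtype.val ha) n

theorem pas_ti {G : Type*} [Group G] [Finite G] (H : Subgroup G) (hmax : IsCoatom H)
    (hab : ∀ x ∈ H, ∀ y ∈ H, x * y = y * x)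
    (hcore : ∀ K : Subgroup G, K.Normal → K ≤ H → K = ⊥)
    (g x : G) (hg : g ∉ H) (hx : x ∈ H) (hgx : g⁻¹ * x * g ∈ H) : x = 1 := by
  have hHC : H ≤ Subgroup.centralizer {x} := by
    intro y hy
    rw [Subgroup.mem_centralizer_singleton_iff]
    exact hab _ hy _ hx
  rcases hmax.le_iff.1 hHC with h | h
  · have hn : (Subgroup.zpowers x).Normal := by
      refine ⟨fun n hn y => ?_⟩
      have hy : y ∈ Subgroup.centralizer {x} := h ▸ Subgroup.mem_top y
      rw [Subgroup.mem_centralizer_singleton_iff] at hy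
      obtain ⟨k, rfl⟩ := Subgroup.mem_zpowers_iff.1 hn
      have : Commute y (x ^ k) := Commute.zpow_right hy k
      rw [this.eq, mul_inv_cancel_right]
      exact hn
    have := hcore _ hn (by rwa [Subgroup.zpowers_le])
    exact Subgroup.zpowers_eq_bot.1 this
  · have hgn : g ∈ Subgroup.normalizer (H : Set G) := by
      refine Subgroup.mem_normalizer_fintype fun n hn => ?_
      have hc := hab _ hn _ hgx
      have : g * n * g⁻¹ ∈ Subgroup.centralizer {x} := by
        rw [Subgroup.mem_centralizer_singleton_iff]
        have h2 : g * (n * (g⁻¹ * x * g)) * g⁻¹ = g * ((g⁻¹ * x * g) * n) * g⁻¹ := by rw [hc]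
        simpa [mul_assoc] using h2
      rw [h] at this
      exact this
    have htop : Subgroup.normalizer (H : Set G) = ⊤ :=
      (hmax.le_iff.1 Subgroup.le_normalizer).resolve_right (fun h => hg (h ▸ hgn))
    have hb := hcore H (Subgroup.normalizer_eq_top_iff.1 htop) le_rfl
    rw [hb] at hx
    exact hx

theorem pas_coprime {G : Type*} [Group G] [Finite G] (H : Subgroup G)
    (hti : ∀ g x : G, g ∉ H → x ∈ H → g⁻¹ * x * g ∈ H → x = 1) :
    (Nat.card H).Coprime H.index := by
  refine Nat.coprime_of_dvd fun q hq hqH hqi => ?_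
  have : Fact q.Prime := ⟨hq⟩
  obtain ⟨x, hx⟩ := exists_prime_orderOf_dvd_card' (G := H) q hqH
  have hpg : IsPGroup q (Subgroup.zpowers x) :=
    IsPGroup.of_card (n := 1) (by rw [Nat.card_zpowers, hx, pow_one])
  have hx1 : (x : G) ≠ 1 := by
    intro h
    have : x = 1 := Subtype.ext h
    rw [this, orderOf_one] at hx
    exact hq.one_lt.ne hx
  have hmod := hpg.card_modEq_card_fixedPoints (G ⧸ H)
  have hfix : MulAction.fixedPoints (Subgroup.zpowers x) (G ⧸ H) = {((1 : G) : G ⧸ H)} := by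
    ext y
    rw [Set.mem_singleton_iff]
    constructor
    · induction y using QuotientGroup.induction_on with
      | H g =>
        intro hy
        have h1 : ((x * g : G) : G ⧸ H) = (g : G ⧸ H) := hy ⟨x, Subgroup.mem_zpowers x⟩
        by_contra hne
        have hg : g ∉ H := fun hg => hne (QuotientGroup.eq.2 (by simpa using hg))
        refine hx1 (hti g x hg x.2 ?_)
        have := QuotientGroup.eq.1 h1.symm
        rwa [← mul_assoc] at this
    · rintro rfl ⟨z, hz⟩
      show ((z * 1 : G) : G ⧸ H) = ((1 : G) : G ⧸ H)
      refine QuotientGroup.eq.2 ?_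
      simp
  rw [hfix, ← Subgroup.index_eq_card] at hmod
  simp only [Nat.card_unique] at hmod
  have h0 : H.index ≡ 0 [MOD q] := Nat.modEq_zero_iff_dvd.2 hqi
  exact hq.one_lt.ne' (Nat.dvd_one.1 (Nat.modEq_zero_iff_dvd.1 (hmod.symm.trans h0)))

theorem pas_complement {G : Type*} [Group G] [Finite G] (H : Subgroup G)
    (hab : ∀ x ∈ H, ∀ y ∈ H, x * y = y * x)
    (hti : ∀ g x : G, g ∉ H → x ∈ H → g⁻¹ * x * g ∈ H → x = 1) :
    ∃ N : Subgroup G, N.Normal ∧ N ⊓ H = ⊥ ∧ N ⊔ H = ⊤ ∧ (Nat.card H).Coprime (Nat.card N) := by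
  have hcop := pas_coprime H hti
  let _ : CommGroup H :=
    { (inferInstance : Group H) with mul_comm := fun a b => Subtype.ext (hab a a.2 b b.2) }
  let V : G →* H := MonoidHom.transfer (MonoidHom.id H)
  have hV : ∀ h : H, V h = h ^ H.index := by
    intro h
    have key : ∀ (k : ℕ) (g₀ : G), g₀⁻¹ * (h : G) ^ k * g₀ ∈ H →
        g₀⁻¹ * (h : G) ^ k * g₀ = (h : G) ^ k := by
      intro k g₀ hk
      have hkH : (h : G) ^ k ∈ H := pow_mem h.2 k
      by_cases hg : g₀ ∈ H
      · rw [mul_assoc, hab _ hkH _ hg, inv_mul_cancel_left]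
      · rw [hti _ _ hg hkH hk]; simp
    exact MonoidHom.transfer_eq_pow (MonoidHom.id H) (h : G) key
  have hbij : Function.Bijective (fun h : H => h ^ H.index) :=
    (powCoprime hcop).bijective
  have hinf : V.ker ⊓ H = ⊥ := by
    rw [eq_bot_iff]
    rintro x ⟨hx, hxH⟩
    have h1 : V x = 1 := hx
    have h2 := hV ⟨x, hxH⟩
    have h3 : (⟨x, hxH⟩ : H) ^ H.index = 1 ^ H.index := by rw [← h2, one_pow]; exact h1
    have h4 : (⟨x, hxH⟩ : H) = 1 := hbij.1 h3
    exact congrArg Subtype.val h4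
  have hsup : V.ker ⊔ H = ⊤ := by
    rw [eq_top_iff]
    intro g _
    obtain ⟨h, hh⟩ := hbij.2 (V g)
    have h1 : g * (h : G)⁻¹ ∈ V.ker := by
      rw [MonoidHom.mem_ker, map_mul, map_inv, hV]
      show V g * (h ^ H.index)⁻¹ = 1
      have hh' : h ^ H.index = V g := hh
      rw [hh', mul_inv_cancel]
    have := Subgroup.mul_mem_sup h1 h.2
    simpa using this
  refine ⟨V.ker, inferInstance, hinf, hsup, ?_⟩
  have hc : Subgroup.IsComplement' V.ker H :=
    Subgroup.isComplement'_of_disjoint_and_mul_eq_univ (disjoint_iff.2 hinf) (by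
      rw [← Subgroup.normal_mul, hsup]; rfl)
  rwa [hc.index_eq_card] at hcop

theorem pas_main {G : Type*} [Group G] [Finite G] (H : Subgroup G) (hmax : IsCoatom H)
    (hab : ∀ x ∈ H, ∀ y ∈ H, x * y = y * x)
    (hcore : ∀ K : Subgroup G, K.Normal → K ≤ H → K = ⊥) :
    ∃ p : ℕ, p.Prime ∧ socle G ≠ ⊥ ∧ socle G ⊓ H = ⊥ ∧ socle G ⊔ H = ⊤ ∧
      (∀ x y : socle G, x * y = y * x) ∧ (∀ x : socle G, x ^ p = 1) ∧
      IsCyclic H ∧ (Nat.card H).Coprime p := by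
  have hti := pas_ti H hmax hab hcore
  obtain ⟨N, hN, hinf, hsup, hcop⟩ := pas_complement H hab hti
  have hNbot : N ≠ ⊥ := by
    rintro rfl
    rw [bot_sup_eq] at hsup
    exact hmax.1 hsup
  have hNnt : Nontrivial N := (Subgroup.nontrivial_iff_ne_bot _).2 hNbot
  let _ : CommGroup H :=
    { (inferInstance : Group H) with mul_comm := fun a b => Subtype.ext (hab a a.2 b b.2) }
  let _ : MulDistribMulAction H N :=
    MulDistribMulAction.compHom N ((MulAut.conjNormal (H := N)).comp H.subtype)
  have hsm : ∀ (a : H) (n : N), ((a • n : N) : G) = a * n * (a : G)⁻¹ := fun a n => rfl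
  have hfree : ∀ a : H, a ≠ 1 → ∀ n : N, a • n = n → n = 1 := by
    intro a ha n hn
    have h1 : (a : G) * n * (a : G)⁻¹ = n := by rw [← hsm, hn]
    by_contra hn1
    refine ha (Subtype.ext (hti n a ?_ a.2 ?_))
    · intro hnH
      have : (n : G) ∈ N ⊓ H := ⟨n.2, hnH⟩
      rw [hinf] at this
      exact hn1 (Subtype.ext this)
    · have h2 : (a : G) * n = n * a := mul_inv_eq_iff_eq_mul.1 h1
      rw [mul_assoc, h2, inv_mul_cancel_left]
      exact a.2
  have hirr : ∀ M : Subgroup N, (∀ a : H, ∀ m ∈ M, a • m ∈ M) → M = ⊥ ∨ M = ⊤ := by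
    intro M hM
    have hMN : M.map N.subtype ≤ N := Subgroup.map_subtype_le M
    have hHn : H ≤ Subgroup.normalizer (M.map N.subtype : Set G) := by
      intro a ha
      refine Subgroup.mem_normalizer_fintype fun n hn => ?_
      obtain ⟨m, hm, rfl⟩ := hn
      exact ⟨_, hM ⟨a, ha⟩ m hm, rfl⟩
    rcases hmax.le_iff.1 (le_sup_right : H ≤ M.map N.subtype ⊔ H) with h | h
    · right
      rw [eq_top_iff]
      intro n _
      have hn : (n : G) ∈ M.map N.subtype ⊔ H := h ▸ Subgroup.mem_top _
      rw [← SetLike.mem_coe, Subgroup.coe_mul_of_right_le_normalizer_left _ _ hHn] at hn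
      obtain ⟨m, hm, y, hy, hmy⟩ := hn
      have hmy' : m * y = n := hmy
      have hyN : y ∈ N ⊓ H := by
        refine ⟨?_, hy⟩
        have : y = m⁻¹ * n := by rw [← hmy', inv_mul_cancel_left]
        rw [this]
        exact N.mul_mem (N.inv_mem (hMN hm)) n.2
      rw [hinf, Subgroup.mem_bot] at hyN
      rw [hyN, mul_one] at hmy'
      obtain ⟨m', hm', hmm⟩ := hm
      have : m' = n := Subtype.ext (hmm.trans hmy')
      exact this ▸ hm'
    · left
      have h1 : M.map N.subtype ≤ N ⊓ H := le_inf hMN (h ▸ le_sup_left)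
      rw [hinf, le_bot_iff] at h1
      exact (Subgroup.map_eq_bot_iff_of_injective _ N.subtype_injective).1 h1
  obtain ⟨p, hp, hcp, hcomm, hpow⟩ := pas_structure hfree hcop hirr
  have hcyc : IsCyclic H := by
    let _ : AddCommGroup (Additive N) :=
      { (inferInstance : AddGroup (Additive N)) with
        add_comm := fun a b => hcomm (Additive.toMul a) (Additive.toMul b) }
    let _ : DistribMulAction H (Additive N) :=
      { smul := fun a n => Additive.ofMul (a • Additive.toMul n)
        one_smul := fun n => one_smul H (Additive.toMul n)
        mul_smul := fun a b n => mul_smul a b (Additive.toMul n)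
        smul_zero := fun a => smul_one (N := N) a
        smul_add := fun a x y => smul_mul' a (Additive.toMul x) (Additive.toMul y) }
    refine pas_cyclic (A := H) (V := Additive N) ?_ ?_
    · intro a ha
      by_contra hne
      obtain ⟨n, hn⟩ := exists_ne (1 : N)
      exact hn (hfree a hne n (ha (Additive.ofMul n)))
    · intro M hM
      have := hirr (AddSubgroup.toSubgroup' M) hM
      rcases this with h | h
      · left
        ext x
        exact SetLike.ext_iff.1 h (Additive.toMul x)
      · right
        ext x
        exact SetLike.ext_iff.1 h (Additive.toMul x)
  have hNmin : IsMinimalNormalSubgroup N := by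
    refine ⟨hN, hNbot, fun M hM hMN hMb => ?_⟩
    rcases hirr (M.subgroupOf N) (fun a m hm => hM.conj_mem _ hm _) with h | h
    · rw [Subgroup.subgroupOf_eq_bot, disjoint_iff, inf_eq_left.2 hMN] at h
      exact absurd h hMb
    · exact le_antisymm hMN (Subgroup.subgroupOf_eq_top.1 h)
  have hcent : Subgroup.centralizer (N : Set G) ≤ N := by
    intro c hc
    have hcs : c ∈ N ⊔ H := hsup ▸ Subgroup.mem_top c
    rw [← SetLike.mem_coe, Subgroup.normal_mul] at hcs
    obtain ⟨n, hn, y, hy, hny⟩ := hcs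
    have hny' : n * y = c := hny
    by_contra hcN
    have hy1 : y ≠ 1 := by
      rintro rfl
      rw [mul_one] at hny'
      exact hcN (hny' ▸ hn)
    obtain ⟨m, hm⟩ := exists_ne (1 : N)
    refine hm (hfree ⟨y, hy⟩ (fun h => hy1 (congrArg Subtype.val h)) m (Subtype.ext ?_))
    rw [hsm]
    show y * m * y⁻¹ = m
    have h1 : (m : G) * c = c * m := Subgroup.mem_centralizer_iff.1 hc m m.2
    have h2 : n * (m : G) = m * n := congrArg Subtype.val (hcomm ⟨n, hn⟩ m)
    rw [mul_inv_eq_iff_eq_mul]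
    rw [← hny', ← mul_assoc, ← h2, mul_assoc, mul_assoc] at h1
    exact (mul_left_cancel h1).symm
  have hsoc : socle G = N := by
    refine le_antisymm (iSup₂_le fun M hM => ?_) (le_iSup₂_of_le N hNmin le_rfl)
    have hMn := hM.1
    by_cases hMN : M ⊓ N = ⊥
    · refine le_trans (fun x hx => ?_) hcent
      rw [Subgroup.mem_centralizer_iff]
      intro n hn
      exact (Subgroup.commute_of_normal_of_disjoint M N hMn hN (disjoint_iff.2 hMN) x n hx hn).symm
    · have := hM.2.2 (M ⊓ N) inferInstance inf_le_left hMN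
      exact inf_eq_left.1 this
  rw [hsoc]
  exact ⟨p, hp, hNbot, hinf, hsup, hcomm, hpow, hcyc, hcp⟩

theorem primitive_with_abelian_stabilizer
    (Ω : Type) [Fintype Ω] (G : Subgroup (Equiv.Perm Ω))
    -- `G` is primitive: transitive with maximal point-stabilizers
    (htrans : MulAction.IsPretransitive G Ω)
    (hprim : ∀ ω : Ω, IsCoatom (MulAction.stabilizer G ω))
    -- a point-stabilizer is abelian
    (habel : ∀ ω : Ω, ∀ x y : MulAction.stabilizer G ω, x * y = y * x) :
    ∃ p : ℕ, p.Prime ∧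
      -- the socle is regular ...
      MulAction.IsPretransitive (socle G) Ω ∧
      (∀ (x : socle G) (ω : Ω), x • ω = ω → x = 1) ∧
      -- ... and an elementary abelian p-group
      (∀ x y : socle G, x * y = y * x) ∧
      (∀ x : socle G, x ^ p = 1) ∧
      -- the point-stabilizers are cyclic of order coprime to p
      ∀ ω : Ω, IsCyclic (MulAction.stabilizer G ω) ∧
        (Nat.card (MulAction.stabilizer G ω)).Coprime p := by
  classical
  rcases isEmpty_or_nonempty Ω with hΩ | ⟨⟨ω₀⟩⟩
  · have hs : Subsingleton G := ⟨fun a b => Subtype.ext (Subsingleton.elim _ _)⟩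
    exact ⟨2, Nat.prime_two, ⟨fun x => isEmptyElim x⟩, fun x ω => isEmptyElim ω,
      fun x y => Subsingleton.elim _ _, fun x => Subsingleton.elim _ _, fun ω => isEmptyElim ω⟩
  have hcore : ∀ ω : Ω, ∀ K : Subgroup G, K.Normal → K ≤ MulAction.stabilizer G ω → K = ⊥ := by
    intro ω K hK hKω
    rw [eq_bot_iff]
    intro k hk
    rw [Subgroup.mem_bot]
    refine Subtype.ext (Equiv.ext fun α => ?_)
    obtain ⟨g, rfl⟩ := htrans.exists_smul_eq ω α
    have h1 : g⁻¹ * k * g ∈ MulAction.stabilizer G ω := by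
      have := hK.conj_mem k hk g⁻¹
      rw [inv_inv] at this
      exact hKω this
    rw [MulAction.mem_stabilizer_iff, mul_smul, mul_smul, inv_smul_eq_iff] at h1
    exact h1
  have main := fun ω => pas_main (MulAction.stabilizer G ω) (hprim ω)
    (fun x hx y hy => congrArg Subtype.val (habel ω ⟨x, hx⟩ ⟨y, hy⟩)) (hcore ω)
  obtain ⟨p, hp, hne, -, hsup, hcomm, hpow, -, -⟩ := main ω₀
  have hsn : (socle G).Normal := by
    have hn : ∀ g : G, Subgroup.map (MulAut.conj g).toMonoidHom (socle G) ≤ socle G := by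
      intro g
      rw [socle, Subgroup.map_iSup]
      refine iSup_le fun N => ?_
      rw [Subgroup.map_iSup]
      refine iSup_le fun hN => ?_
      refine le_trans ?_ (le_iSup₂_of_le N hN le_rfl)
      rintro _ ⟨x, hx, rfl⟩
      exact hN.1.conj_mem x hx g
    exact ⟨fun n hn' g => hn g ⟨n, hn', rfl⟩⟩
  refine ⟨p, hp, ?_, ?_, hcomm, hpow, ?_⟩
  · have h0 : ∀ α : Ω, ∃ s : socle G, s • ω₀ = α := by
      intro α
      obtain ⟨g, rfl⟩ := htrans.exists_smul_eq ω₀ α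
      have hg : g ∈ socle G ⊔ MulAction.stabilizer G ω₀ := hsup ▸ Subgroup.mem_top g
      rw [← SetLike.mem_coe, Subgroup.normal_mul] at hg
      obtain ⟨n, hn, y, hy, rfl⟩ := hg
      refine ⟨⟨n, hn⟩, ?_⟩
      have hy' : y • ω₀ = ω₀ := hy
      show n • ω₀ = (n * y) • ω₀
      rw [mul_smul, hy']
    refine ⟨fun α β => ?_⟩
    obtain ⟨s, rfl⟩ := h0 α
    obtain ⟨t, rfl⟩ := h0 β
    exact ⟨t * s⁻¹, by rw [mul_smul, inv_smul_smul]⟩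
  · intro x ω hx
    obtain ⟨-, -, -, hinf, -⟩ := main ω
    have : (x : G) ∈ socle G ⊓ MulAction.stabilizer G ω := ⟨x.2, hx⟩
    rw [hinf] at this
    exact Subtype.ext this
  · intro ω
    obtain ⟨q, hq, -, -, -, -, hqpow, hcyc, hcop⟩ := main ω
    refine ⟨hcyc, ?_⟩
    have hnt : Nontrivial (socle G) := (Subgroup.nontrivial_iff_ne_bot _).2 hne
    obtain ⟨x, hx⟩ := exists_ne (1 : socle G)
    have : Fact p.Prime := ⟨hp⟩
    have : Fact q.Prime := ⟨hq⟩
    have h1 : orderOf x = p := orderOf_eq_prime (hpow x) hx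
    have h2 : orderOf x = q := orderOf_eq_prime (hqpow x) hx
    rw [← h1, h2]
    exact hcop
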